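/- The operation ✶ on L is increasing with respect to ⊑: for all f, g, h ∈ L with f ⊑ g, one has f✶h ⊑ g✶h. -/

import Mathlib

noncomputable section

attribute [local instance] Classical.propDecidable

instance : Fact ((0:ℝ) ≤ 1) := ⟨zero_le_one⟩

/-- The unit interval `I = [0,1]`. -/
abbrev I01 := unitInterval

/-- `f^L (x) = sup {f y | y ≤ x}`. -/
def funL (f : I01 → I01) (x : I01) : I01 := sSup (f '' {y | y ≤ x})

/-- `f^R (x) = sup {f y | y ≥ x}`. -/
def funR (f : I01 → I01) (x : I01) : I01 := sSup (f '' {y | x ≤ y})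

/-- `f^{Lw}`. -/
def funLw (f : I01 → I01) (x : I01) : I01 :=
  if x = 0 then f 0 else sSup (f '' {y | y < x})

/-- A function is normal if `sup {f x | x ∈ I} = 1`. -/
def NormalFn (f : I01 → I01) : Prop := sSup (Set.range f) = 1

/-- A function is convex in the fuzzy sense. -/
def ConvexFn (f : I01 → I01) : Prop :=
  ∀ x y z : I01, x ≤ y → y ≤ z → min (f x) (f z) ≤ f y

/-- `L`, the set of all normal and convex functions from `I` to `I`. -/
def NC : Set (I01 → I01) := {f | NormalFn f ∧ ConvexFn f}

/-- Characteristic function of a subset of `I`. -/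
def ind (B : Set I01) : I01 → I01 := fun x => if x ∈ B then 1 else 0

/-- `(f ⊓ g)(x) = sup {min (f y) (g z) | min y z = x}`. -/
def meet (f g : I01 → I01) : I01 → I01 := fun x =>
  sSup {v | ∃ y z : I01, min y z = x ∧ v = min (f y) (g z)}

/-- The partial order `f ⊑ g` iff `f ⊓ g = f`. -/
def sqle (f g : I01 → I01) : Prop := meet f g = f

/-- `η_{f,g}`. -/
def etaLG (f g : I01 → I01) : I01 :=
  min (sInf {x | funL f x = 1}) (sInf {x | funL g x = 1})

/-- `ξ_{f,g}`. -/
def xiLG (f g : I01 → I01) : I01 :=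
  min (sSup {x | funR f x = 1}) (sSup {x | funR g x = 1})

/-- The operation `✶`. -/
def starOp (f g : I01 → I01) : I01 → I01 :=
  if f = ind {1} then g
  else if g = ind {1} then f
  else fun t =>
    if t < etaLG f g then max (funL f t) (funL g t)
    else if t < xiLG f g then 1
    else if t = xiLG f g then min (funR f (xiLG f g)) (funR g (xiLG f g))
    else 0

/-- A t-norm on `I`. -/
structure IsTnormI (op : I01 → I01 → I01) : Prop where
  comm : ∀ x y : I01, op x y = op y x
  assoc : ∀ x y z : I01, op (op x y) z = op x (op y z)
  mono : ∀ x y z : I01, x ≤ y → op x z ≤ op y z ∧ op z x ≤ op z y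
  one_op : ∀ x : I01, op 1 x = x
  op_one : ∀ x : I01, op x 1 = x

/-- A t-conorm on `I`. -/
structure IsTconormI (op : I01 → I01 → I01) : Prop where
  comm : ∀ x y : I01, op x y = op y x
  assoc : ∀ x y z : I01, op (op x y) z = op x (op y z)
  mono : ∀ x y z : I01, x ≤ y → op x z ≤ op y z ∧ op z x ≤ op z y
  zero_op : ∀ x : I01, op 0 x = x
  op_zero : ∀ x : I01, op x 0 = x

/-- The convolution operation `(f ⋏ g)(x) = sup {st (f y) (g z) | tri y z = x}`. -/
def conv (st tri : I01 → I01 → I01) (f g : I01 → I01) : I01 → I01 := fun x =>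
  sSup {v | ∃ y z : I01, tri y z = x ∧ v = st (f y) (g z)}

/-- Complementation `(¬ f)(x) = f (1 - x)`. -/
def negf (f : I01 → I01) : I01 → I01 := fun x => f (unitInterval.symm x)

/-- The dual operation `f ◇^∁ g = ¬((¬f) ◇ (¬g))`. -/
def dualOp (op : (I01 → I01) → (I01 → I01) → (I01 → I01)) :
    (I01 → I01) → (I01 → I01) → (I01 → I01) :=
  fun f g => negf (op (negf f) (negf g))

/-- A t-norm on `L` according to the basic axioms (O1)--(O4). -/
def IsTnormOnL (T : (I01 → I01) → (I01 → I01) → (I01 → I01)) : Prop :=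
  (∀ f ∈ NC, ∀ g ∈ NC, T f g = T g f) ∧
  (∀ f ∈ NC, ∀ g ∈ NC, ∀ h ∈ NC, T (T f g) h = T f (T g h)) ∧
  (∀ f ∈ NC, T f (ind {1}) = f) ∧
  (∀ f ∈ NC, ∀ g ∈ NC, ∀ h ∈ NC, sqle f g → sqle (T f h) (T g h))

/-- A t-conorm on `L` according to the basic axioms (O1), (O2), (O3'), (O4). -/
def IsTconormOnL (S : (I01 → I01) → (I01 → I01) → (I01 → I01)) : Prop :=
  (∀ f ∈ NC, ∀ g ∈ NC, S f g = S g f) ∧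
  (∀ f ∈ NC, ∀ g ∈ NC, ∀ h ∈ NC, S (S f g) h = S f (S g h)) ∧
  (∀ f ∈ NC, S f (ind {0}) = f) ∧
  (∀ f ∈ NC, ∀ g ∈ NC, ∀ h ∈ NC, sqle f g → sqle (S f h) (S g h))

/-- A `t_r`-norm on `L`: an operation on `L` satisfying axioms (O1)--(O7). -/
def IsTrNorm (T : (I01 → I01) → (I01 → I01) → (I01 → I01)) : Prop :=
  (∀ f ∈ NC, ∀ g ∈ NC, T f g ∈ NC) ∧
  (∀ f ∈ NC, ∀ g ∈ NC, T f g = T g f) ∧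
  (∀ f ∈ NC, ∀ g ∈ NC, ∀ h ∈ NC, T (T f g) h = T f (T g h)) ∧
  (∀ f ∈ NC, T f (ind {1}) = f) ∧
  (∀ f ∈ NC, ∀ g ∈ NC, ∀ h ∈ NC, sqle f g → sqle (T f h) (T g h)) ∧
  (∀ a b : I01, a ≤ b → T (ind (Set.Icc 0 1)) (ind (Set.Icc a b)) = ind (Set.Icc 0 b)) ∧
  (∀ x₁ x₂ : I01, ∃ x₃ : I01, T (ind {x₁}) (ind {x₂}) = ind {x₃}) ∧
  (∀ a₁ b₁ a₂ b₂ : I01, a₁ ≤ b₁ → a₂ ≤ b₂ →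
    ∃ a₃ b₃ : I01, a₃ ≤ b₃ ∧
      T (ind (Set.Icc a₁ b₁)) (ind (Set.Icc a₂ b₂)) = ind (Set.Icc a₃ b₃))

/-- A `t_r`-conorm on `L`: an operation on `L` satisfying axioms
(O1), (O2), (O3'), (O4), (O5'), (O6), (O7). -/
def IsTrConorm (S : (I01 → I01) → (I01 → I01) → (I01 → I01)) : Prop :=
  (∀ f ∈ NC, ∀ g ∈ NC, S f g ∈ NC) ∧
  (∀ f ∈ NC, ∀ g ∈ NC, S f g = S g f) ∧
  (∀ f ∈ NC, ∀ g ∈ NC, ∀ h ∈ NC, S (S f g) h = S f (S g h)) ∧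
  (∀ f ∈ NC, S f (ind {0}) = f) ∧
  (∀ f ∈ NC, ∀ g ∈ NC, ∀ h ∈ NC, sqle f g → sqle (S f h) (S g h)) ∧
  (∀ a b : I01, a ≤ b → S (ind (Set.Icc 0 1)) (ind (Set.Icc a b)) = ind (Set.Icc a 1)) ∧
  (∀ x₁ x₂ : I01, ∃ x₃ : I01, S (ind {x₁}) (ind {x₂}) = ind {x₃}) ∧
  (∀ a₁ b₁ a₂ b₂ : I01, a₁ ≤ b₁ → a₂ ≤ b₂ →
    ∃ a₃ b₃ : I01, a₃ ≤ b₃ ∧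
      S (ind (Set.Icc a₁ b₁)) (ind (Set.Icc a₂ b₂)) = ind (Set.Icc a₃ b₃))

theorem le_funL {f : I01 → I01} {x y : I01} (h : y ≤ x) : f y ≤ funL f x :=
  le_sSup ⟨y, h, rfl⟩

theorem le_funR {f : I01 → I01} {x y : I01} (h : x ≤ y) : f y ≤ funR f x :=
  le_sSup ⟨y, h, rfl⟩

theorem funL_le {f : I01 → I01} {x b : I01} (h : ∀ y ≤ x, f y ≤ b) : funL f x ≤ b :=
  sSup_le (by rintro _ ⟨y, hy, rfl⟩; exact h y hy)

theorem funR_le {f : I01 → I01} {x b : I01} (h : ∀ y, x ≤ y → f y ≤ b) : funR f x ≤ b :=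
  sSup_le (by rintro _ ⟨y, hy, rfl⟩; exact h y hy)

theorem funL_mono (f : I01 → I01) : Monotone (funL f) :=
  fun _ _ hxy => funL_le fun _ hz => le_funL (hz.trans hxy)

theorem funR_anti (f : I01 → I01) : Antitone (funR f) :=
  fun _ _ hxy => funR_le fun _ hz => le_funR (hxy.trans hz)

theorem le_one_I01 (x : I01) : x ≤ 1 := unitInterval.le_one'

theorem zero_le_I01 (x : I01) : 0 ≤ x := unitInterval.nonneg'

theorem NormalFn.eq_one_of_forall_le {f : I01 → I01} (hf : NormalFn f) {b : I01}
    (h : ∀ y, f y ≤ b) : b = 1 := by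
  refine le_antisymm (le_one_I01 b) ?_
  rw [← show sSup (Set.range f) = 1 from hf]
  exact sSup_le (by rintro _ ⟨y, rfl⟩; exact h y)

theorem sqle.funR_le_funR {f g : I01 → I01} (h : sqle f g) (t : I01) :
    funR f t ≤ funR g t := by
  refine funR_le fun x hx => ?_
  rw [← show meet f g = f from h]
  refine sSup_le ?_
  rintro _ ⟨y, z, rfl, rfl⟩
  exact (min_le_right _ _).trans (le_funR (hx.trans (min_le_right _ _)))

theorem sqle.funL_le_funL {f g : I01 → I01} (hf : NormalFn f) (h : sqle f g) (t : I01) :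
    funL g t ≤ funL f t := by
  refine funL_le fun z hz => ?_
  by_contra! hlt
  refine (hlt.trans_le (le_one_I01 _)).ne (hf.eq_one_of_forall_le fun y => ?_)
  have hmin : min (f y) (g z) ≤ funL f t := by
    refine le_trans ?_ (le_funL ((min_le_right y z).trans hz))
    conv_rhs => rw [← show meet f g = f from h]
    exact le_sSup ⟨y, z, rfl, rfl⟩
  exact (min_le_iff.1 hmin).resolve_right hlt.not_ge

theorem ConvexFn.sqle_of_le {f g : I01 → I01} (hf : ConvexFn f)
    (hL : ∀ t, funL g t ≤ funL f t) (hR : ∀ t, funR f t ≤ funR g t) : sqle f g := by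
  funext x
  apply le_antisymm
  · refine sSup_le ?_
    rintro _ ⟨y, z, hx, rfl⟩
    rcases le_total y z with hyz | hyz
    · rw [min_eq_left hyz] at hx
      exact hx ▸ min_le_left _ _
    · rw [min_eq_right hyz] at hx
      subst hx
      by_contra! hlt
      obtain ⟨hy, hz⟩ := lt_min_iff.1 hlt
      refine (hz.trans_le ((le_funL le_rfl).trans (hL z))).not_ge (funL_le fun w hw => ?_)
      exact (min_le_iff.1 (hf w z y hw hyz)).resolve_right hy.not_ge
  · by_contra! hlt
    refine (hlt.trans_le ((le_funR le_rfl).trans (hR x))).not_ge (funR_le fun z hz => ?_)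
    have hmin : min (f x) (g z) ≤ meet f g x := le_sSup ⟨x, z, min_eq_left hz, rfl⟩
    exact (min_le_iff.1 hmin).resolve_left hlt.not_ge

theorem NormalFn.sInf_le_sSup {f : I01 → I01} (hf : NormalFn f) :
    sInf {x | funL f x = 1} ≤ sSup {x | funR f x = 1} := by
  by_contra! hlt
  obtain ⟨x, hRx, hLx⟩ := exists_between hlt
  have h1 : funL f x ≠ 1 := fun h => hLx.not_ge (sInf_le h)
  have h2 : funR f x ≠ 1 := fun h => hRx.not_ge (le_sSup h)
  have hmax := hf.eq_one_of_forall_le (b := max (funL f x) (funR f x)) fun y =>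
    (le_total y x).elim (fun h => (le_funL h).trans (le_max_left _ _))
      fun h => (le_funR h).trans (le_max_right _ _)
  rcases max_choice (funL f x) (funR f x) with h | h
  · exact h1 (h ▸ hmax)
  · exact h2 (h ▸ hmax)

theorem funR_eq_one_of_lt {f : I01 → I01} {t : I01}
    (ht : t < sSup {x | funR f x = 1}) : funR f t = 1 := by
  by_contra hne
  refine ht.not_ge (sSup_le fun x hx => ?_)
  by_contra! hlt
  exact hne (le_antisymm (le_one_I01 _) ((show funR f x = 1 from hx) ▸ funR_anti f hlt.le))

theorem etaLG_le_xiLG {f h : I01 → I01} (hf : NormalFn f) (hh : NormalFn h) :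
    etaLG f h ≤ xiLG f h :=
  min_le_min hf.sInf_le_sSup hh.sInf_le_sSup

section starOp

variable {f h : I01 → I01} {t : I01}

theorem starOp_of_lt_etaLG (hf1 : f ≠ ind {1}) (hh1 : h ≠ ind {1}) (ht : t < etaLG f h) :
    starOp f h t = max (funL f t) (funL h t) := by
  simp [starOp, hf1, hh1, ht]

theorem starOp_of_lt_xiLG (hf1 : f ≠ ind {1}) (hh1 : h ≠ ind {1}) (ht : etaLG f h ≤ t)
    (ht' : t < xiLG f h) : starOp f h t = 1 := by
  simp [starOp, hf1, hh1, ht.not_gt, ht']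

theorem starOp_xiLG (hf : NormalFn f) (hh : NormalFn h) (hf1 : f ≠ ind {1})
    (hh1 : h ≠ ind {1}) :
    starOp f h (xiLG f h) = min (funR f (xiLG f h)) (funR h (xiLG f h)) := by
  simp [starOp, hf1, hh1, (etaLG_le_xiLG hf hh).not_gt]

theorem starOp_of_xiLG_lt (hf : NormalFn f) (hh : NormalFn h) (hf1 : f ≠ ind {1})
    (hh1 : h ≠ ind {1}) (ht : xiLG f h < t) : starOp f h t = 0 := by
  simp [starOp, hf1, hh1, ((etaLG_le_xiLG hf hh).trans_lt ht).not_gt, ht.not_gt, ht.ne']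

theorem starOp_mono_of_lt_etaLG (hf1 : f ≠ ind {1}) (hh1 : h ≠ ind {1}) {x : I01}
    (hx : x ≤ t) (ht : t < etaLG f h) : starOp f h x ≤ starOp f h t := by
  rw [starOp_of_lt_etaLG hf1 hh1 ht, starOp_of_lt_etaLG hf1 hh1 (hx.trans_lt ht)]
  exact max_le_max (funL_mono f hx) (funL_mono h hx)

theorem normalFn_starOp (hf : NormalFn f) (hh : NormalFn h) (hf1 : f ≠ ind {1})
    (hh1 : h ≠ ind {1}) : NormalFn (starOp f h) := by
  set b := sSup (Set.range (starOp f h))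
  have hle : ∀ y, starOp f h y ≤ b := fun y => le_sSup ⟨y, rfl⟩
  change b = 1
  rcases (etaLG_le_xiLG hf hh).lt_or_eq with hlt | heq
  · exact le_antisymm (le_one_I01 _) (starOp_of_lt_xiLG hf1 hh1 le_rfl hlt ▸ hle _)
  have key : ∀ p : I01 → I01, NormalFn p →
      (∀ y < xiLG f h, funL p y ≤ b) → funR p (xiLG f h) ≤ b → b = 1 :=
    fun p hp hL hR => hp.eq_one_of_forall_le fun y =>
      (lt_or_ge y (xiLG f h)).elim (fun hy => (le_funL le_rfl).trans (hL y hy))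
        fun hy => (le_funR hy).trans hR
  have hbelow : ∀ y < xiLG f h, max (funL f y) (funL h y) ≤ b := fun y hy =>
    starOp_of_lt_etaLG hf1 hh1 (heq ▸ hy) ▸ hle y
  rcases min_le_iff.1 (starOp_xiLG hf hh hf1 hh1 ▸ hle (xiLG f h)) with hR | hR
  · exact key f hf (fun y hy => (le_max_left _ _).trans (hbelow y hy)) hR
  · exact key h hh (fun y hy => (le_max_right _ _).trans (hbelow y hy)) hR

theorem convexFn_starOp (hf : NormalFn f) (hh : NormalFn h) (hf1 : f ≠ ind {1})
    (hh1 : h ≠ ind {1}) : ConvexFn (starOp f h) := by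
  intro x y z hxy hyz
  rcases hyz.eq_or_lt with rfl | hyz
  · exact min_le_right _ _
  rcases lt_or_ge y (etaLG f h) with hy | hy
  · exact (min_le_left _ _).trans (starOp_mono_of_lt_etaLG hf1 hh1 hxy hy)
  rcases lt_or_ge y (xiLG f h) with hy' | hy'
  · rw [starOp_of_lt_xiLG hf1 hh1 hy hy']
    exact le_one_I01 _
  · refine (min_le_right _ _).trans ?_
    rw [starOp_of_xiLG_lt hf hh hf1 hh1 (hy'.trans_lt hyz)]
    exact zero_le_I01 _

theorem funL_starOp_of_lt (hf1 : f ≠ ind {1}) (hh1 : h ≠ ind {1}) (ht : t < etaLG f h) :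
    funL (starOp f h) t = max (funL f t) (funL h t) := by
  rw [← starOp_of_lt_etaLG hf1 hh1 ht]
  exact le_antisymm (funL_le fun y hy => starOp_mono_of_lt_etaLG hf1 hh1 hy ht)
    (le_funL le_rfl)

theorem funL_starOp_of_le (hf : NormalFn f) (hh : NormalFn h) (hf1 : f ≠ ind {1})
    (hh1 : h ≠ ind {1}) (ht : etaLG f h ≤ t) : funL (starOp f h) t = 1 := by
  refine (normalFn_starOp hf hh hf1 hh1).eq_one_of_forall_le fun y => ?_
  rcases le_or_gt y t with hy | hy
  · exact le_funL hy
  rcases lt_or_ge t (xiLG f h) with ht' | ht'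
  · exact (le_one_I01 _).trans (starOp_of_lt_xiLG hf1 hh1 ht ht' ▸ le_funL le_rfl)
  · rw [starOp_of_xiLG_lt hf hh hf1 hh1 (ht'.trans_lt hy)]
    exact zero_le_I01 _

theorem funR_starOp_of_lt (hf : NormalFn f) (hh : NormalFn h) (hf1 : f ≠ ind {1})
    (hh1 : h ≠ ind {1}) (ht : t < xiLG f h) : funR (starOp f h) t = 1 := by
  refine (normalFn_starOp hf hh hf1 hh1).eq_one_of_forall_le fun y => ?_
  rcases le_or_gt t y with hy | hy
  · exact le_funR hy
  refine le_trans ?_ (le_funR (le_refl t))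
  rcases lt_or_ge t (etaLG f h) with ht' | ht'
  · exact starOp_mono_of_lt_etaLG hf1 hh1 hy.le ht'
  · rw [starOp_of_lt_xiLG hf1 hh1 ht' ht]
    exact le_one_I01 _

theorem funR_starOp_xiLG (hf : NormalFn f) (hh : NormalFn h) (hf1 : f ≠ ind {1})
    (hh1 : h ≠ ind {1}) :
    funR (starOp f h) (xiLG f h) = min (funR f (xiLG f h)) (funR h (xiLG f h)) := by
  rw [← starOp_xiLG hf hh hf1 hh1]
  refine le_antisymm (funR_le fun y hy => ?_) (le_funR le_rfl)
  rcases hy.eq_or_lt with rfl | hy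
  · exact le_rfl
  · rw [starOp_of_xiLG_lt hf hh hf1 hh1 hy]
    exact zero_le_I01 _

theorem funR_starOp_of_gt (hf : NormalFn f) (hh : NormalFn h) (hf1 : f ≠ ind {1})
    (hh1 : h ≠ ind {1}) (ht : xiLG f h < t) : funR (starOp f h) t = 0 :=
  le_antisymm
    (funR_le fun _ hy => (starOp_of_xiLG_lt hf hh hf1 hh1 (ht.trans_le hy)).le)
    (zero_le_I01 _)

/-- A criterion for `f ✶ h ⊑ k` in terms of bounds on `k^L` and `k^R`. -/
theorem starOp_sqle (hf : NormalFn f) (hh : NormalFn h) (hf1 : f ≠ ind {1})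
    (hh1 : h ≠ ind {1}) {k : I01 → I01}
    (hL : ∀ t < etaLG f h, funL k t ≤ max (funL f t) (funL h t))
    (hR : ∀ t < xiLG f h, funR k t = 1)
    (hxi : min (funR f (xiLG f h)) (funR h (xiLG f h)) ≤ funR k (xiLG f h)) :
    sqle (starOp f h) k := by
  refine (convexFn_starOp hf hh hf1 hh1).sqle_of_le (fun t => ?_) fun t => ?_
  · rcases lt_or_ge t (etaLG f h) with ht | ht
    · exact funL_starOp_of_lt hf1 hh1 ht ▸ hL t ht
    · exact funL_starOp_of_le hf hh hf1 hh1 ht ▸ le_one_I01 _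
  · rcases lt_trichotomy t (xiLG f h) with ht | rfl | ht
    · exact hR t ht ▸ le_one_I01 _
    · exact funR_starOp_xiLG hf hh hf1 hh1 ▸ hxi
    · exact funR_starOp_of_gt hf hh hf1 hh1 ht ▸ zero_le_I01 _

theorem starOp_sqle_right (hf : NormalFn f) (hh : NormalFn h) (hf1 : f ≠ ind {1})
    (hh1 : h ≠ ind {1}) : sqle (starOp f h) h :=
  starOp_sqle hf hh hf1 hh1 (fun _ _ => le_max_right _ _)
    (fun _ ht => funR_eq_one_of_lt (ht.trans_le (min_le_right _ _))) (min_le_right _ _)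

end starOp

theorem etaLG_mono_left {f g : I01 → I01} (h : I01 → I01)
    (hL : ∀ t, funL g t ≤ funL f t) : etaLG f h ≤ etaLG g h :=
  min_le_min_right _ <| sInf_le_sInf fun t ht =>
    le_antisymm (le_one_I01 _) ((show funL g t = 1 from ht) ▸ hL t)

theorem xiLG_mono_left {f g : I01 → I01} (h : I01 → I01)
    (hR : ∀ t, funR f t ≤ funR g t) : xiLG f h ≤ xiLG g h :=
  min_le_min_right _ <| sSup_le_sSup fun t ht =>
    le_antisymm (le_one_I01 _) ((show funR f t = 1 from ht) ▸ hR t)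

theorem eq_ind_one_of_ind_one_sqle {g : I01 → I01} (hg : NormalFn g)
    (hL : ∀ t, funL g t ≤ funL (ind {1}) t) : g = ind {1} := by
  have h0 : ∀ t, t ≠ 1 → g t = 0 := fun t ht =>
    le_antisymm ((le_funL le_rfl).trans ((hL t).trans (funL_le fun y hy => by
      have hy1 : y ≠ 1 := (hy.trans_lt ((le_one_I01 t).lt_of_ne ht)).ne
      simp [ind, hy1]))) (zero_le_I01 _)
  funext t
  rcases eq_or_ne t 1 with rfl | ht
  · simp only [ind, Set.mem_singleton_iff, if_true]
    refine hg.eq_one_of_forall_le fun y => ?_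
    rcases eq_or_ne y 1 with rfl | hy
    · exact le_rfl
    · exact h0 y hy ▸ zero_le_I01 _
  · simp [ind, ht, h0 t ht]

/-- `✶` is increasing with respect to `⊑`. -/
theorem stmt11 (f g h : I01 → I01) (hf : f ∈ NC) (hg : g ∈ NC) (hh : h ∈ NC)
    (hfg : sqle f g) : sqle (starOp f h) (starOp g h) := by
  have hL := hfg.funL_le_funL hf.1
  have hR := hfg.funR_le_funR
  by_cases hf1 : f = ind {1}
  · subst hf1
    rw [eq_ind_one_of_ind_one_sqle hg.1 hL]
    simpa [starOp] using hh.2.sqle_of_le (fun _ => le_rfl) fun _ => le_rfl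
  by_cases hh1 : h = ind {1}
  · have hstar : ∀ p, starOp p h = p := fun p => by
      by_cases hp : p = ind {1} <;> simp [starOp, hp, hh1]
    rwa [hstar, hstar]
  by_cases hg1 : g = ind {1}
  · rw [show starOp g h = h by simp [starOp, hg1]]
    exact starOp_sqle_right hf.1 hh.1 hf1 hh1
  have heta := etaLG_mono_left h hL
  have hxi := xiLG_mono_left h hR
  refine starOp_sqle hf.1 hh.1 hf1 hh1 (fun t ht => ?_) (fun t ht => ?_) ?_
  · rw [funL_starOp_of_lt hg1 hh1 (ht.trans_le heta)]
    exact max_le_max (hL t) le_rfl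
  · exact funR_starOp_of_lt hg.1 hh.1 hg1 hh1 (ht.trans_le hxi)
  · rcases hxi.eq_or_lt with heq | hlt
    · rw [heq, funR_starOp_xiLG hg.1 hh.1 hg1 hh1]
      exact min_le_min (hR _) le_rfl
    · rw [funR_starOp_of_lt hg.1 hh.1 hg1 hh1 hlt]
      exact le_one_I01 _
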